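/- Fix a positive integer r. For every ε > 0 there exists a constant C = C(r,ε) > 0 such that for every σ ∈ ℂ and every positive integer N, the number T_r(σ,N) of tuples (x_1,…,x_{2r}) of positive integers with x_i ≤ N, σ + x_i ≠ 0 for all i, and 1/(σ+x_1) + … + 1/(σ+x_r) = 1/(σ+x_{r+1}) + … + 1/(σ+x_{2r}), satisfies T_r(σ,N) ≤ C·N^{r+ε}. -/

import Mathlib

open Finset
open scoped Classical

/-- The least positive integer `n` such that `n / (σ + a)` is an algebraic integer
(`0` if there is none). -/
noncomputable def shiftDenom (σ : ℂ) (a : ℕ) : ℕ := Algebra.natDenominator (σ + a)⁻¹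

theorem shiftDenom_dvd_iff {σ : ℂ} {a : ℕ} {n : ℤ} :
    (shiftDenom σ a : ℤ) ∣ n ↔ IsIntegral ℤ (n * (σ + a)⁻¹) := by
  rw [shiftDenom, Algebra.natDenominator_def, Int.natAbs_dvd, Algebra.denominator_dvd_iff,
    zsmul_eq_mul]

theorem Nat.Prime.pow_dvd_finset_lcm {ι : Type*} {p k : ℕ} (hp : p.Prime) (hk : k ≠ 0)
    {s : Finset ι} {f : ι → ℕ} (h : p ^ k ∣ s.lcm f) : ∃ i ∈ s, p ^ k ∣ f i := by
  induction s using Finset.induction_on with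
  | empty =>
    simp only [lcm_empty, Nat.dvd_one, Nat.pow_eq_one] at h
    exact absurd h (by simp [hp.ne_one, hk])
  | insert a s ha ih =>
    rw [Finset.lcm_insert] at h
    have : p ^ k ∣ f a ∨ p ^ k ∣ s.lcm f := by
      rcases eq_or_ne (f a) 0 with h1 | h1
      · simp [h1]
      rcases eq_or_ne (s.lcm f) 0 with h2 | h2
      · simp [h2]
      have h3 : p ^ k ∣ Nat.lcm (f a) (s.lcm f) := h
      rw [hp.pow_dvd_iff_le_factorization (Nat.lcm_ne_zero h1 h2),
        Nat.factorization_lcm h1 h2, Finsupp.sup_apply, le_sup_iff] at h3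
      rwa [hp.pow_dvd_iff_le_factorization h1, hp.pow_dvd_iff_le_factorization h2]
    rcases this with h | h
    · exact ⟨a, by simp, h⟩
    · obtain ⟨i, hi, h⟩ := ih h
      exact ⟨i, by simp [hi], h⟩

theorem dvd_lcm_gcd {ι : Type*} {n : ℕ} {s : Finset ι} {f : ι → ℕ} (h : n ∣ s.lcm f) :
    n ∣ s.lcm fun i ↦ n.gcd (f i) := by
  rw [Nat.dvd_iff_prime_pow_dvd_dvd]
  intro p k hp hpk
  rcases eq_or_ne k 0 with rfl | hk
  · simp
  obtain ⟨i, hi, hpi⟩ := hp.pow_dvd_finset_lcm hk (hpk.trans h)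
  exact (Nat.dvd_gcd hpk hpi).trans (Finset.dvd_lcm (f := fun i ↦ n.gcd (f i)) hi)

theorem gcd_shiftDenom_dvd {σ : ℂ} {a b : ℕ} (ha : σ + a ≠ 0) (hb : σ + b ≠ 0)
    (ha0 : shiftDenom σ a ≠ 0) :
    (shiftDenom σ a).gcd ((b : ℤ) - a).natAbs ∣ shiftDenom σ b := by
  set g := (shiftDenom σ a).gcd ((b : ℤ) - a).natAbs with hg
  have hg0 : g ≠ 0 := fun h ↦ ha0 (Nat.eq_zero_of_gcd_eq_zero_left h)
  obtain ⟨m, hm⟩ : g ∣ shiftDenom σ a := Nat.gcd_dvd_left _ _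
  obtain ⟨e, he⟩ : (g : ℤ) ∣ (b : ℤ) - a := Int.natCast_dvd.2 (Nat.gcd_dvd_right _ _)
  have hm0 : m ≠ 0 := by rintro rfl; simp [hm] at ha0
  have hA : IsIntegral ℤ (((shiftDenom σ a : ℤ) : ℂ) * (σ + a)⁻¹) :=
    shiftDenom_dvd_iff.1 dvd_rfl
  have hB : IsIntegral ℤ (((shiftDenom σ b : ℤ) : ℂ) * (σ + b)⁻¹) :=
    shiftDenom_dvd_iff.1 dvd_rfl
  have key : (shiftDenom σ a : ℤ) ∣ (shiftDenom σ b : ℤ) * m := by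
    rw [shiftDenom_dvd_iff]
    have hint := (hB.mul (isIntegral_algebraMap (R := ℤ) (x := (m : ℤ)))).add
      ((hB.mul (isIntegral_algebraMap (R := ℤ) (x := e))).mul hA)
    refine (congrArg (IsIntegral ℤ) ?_).mpr hint
    have h1 : (shiftDenom σ a : ℂ) = g * m := by rw [hm]; push_cast; ring
    have h2 : (b : ℂ) = a + g * e := by
      have : (b : ℤ) = a + g * e := by linarith
      exact_mod_cast this
    rw [h2] at hb ⊢
    simp only [Int.cast_mul, Int.cast_natCast, h1, algebraMap_int_eq, eq_intCast]
    field_simp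
    ring
  have key' : g * m ∣ shiftDenom σ b * m := by
    rw [← hm]; exact_mod_cast key
  exact Nat.dvd_of_mul_dvd_mul_right (Nat.pos_of_ne_zero hm0) key'

open Polynomial in
theorem shiftDenom_dvd_mul_lcm {σ : ℂ} {S : Finset ℕ} {c : ℕ → ℤ}
    (hS : ∀ v ∈ S, σ + v ≠ 0) (hsum : ∑ v ∈ S, c v * (σ + v)⁻¹ = 0) {a : ℕ} (ha : a ∈ S) :
    (shiftDenom σ a : ℤ) ∣ c a * ((S.erase a).lcm fun b ↦ ((b : ℤ) - a).natAbs : ℕ) := by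
  set L : ℕ := (S.erase a).lcm fun b ↦ ((b : ℤ) - a).natAbs with hL
  have hdvd : ∀ b ∈ S.erase a, ∃ l : ℤ, ((b : ℤ) - a) * l = L := fun b hb ↦ by
    have : ((b : ℤ) - a).natAbs ∣ L :=
      Finset.dvd_lcm (f := fun b : ℕ ↦ ((b : ℤ) - a).natAbs) hb
    obtain ⟨l, hl⟩ := Int.natAbs_dvd.1 (Int.natCast_dvd_natCast.2 this)
    exact ⟨l, hl.symm⟩
  choose! l hl using hdvd
  rcases eq_or_ne (c a) 0 with hca | hca
  · simp [hca]
  have haσ := hS a ha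
  let P : ℤ[X] := ∏ b ∈ S.erase a, (X + C (l b))
  have hP : P.Monic := monic_prod_of_monic _ _ fun b _ ↦ monic_X_add_C _
  let R : ℤ[X] := ∑ b ∈ S.erase a, C (c b * l b) * ∏ i ∈ (S.erase a).erase b, (X + C (l i))
  have hPdeg : P.natDegree = #(S.erase a) := by
    rw [natDegree_prod_of_monic _ _ fun b _ ↦ monic_X_add_C _]
    simp only [natDegree_X_add_C, sum_const, smul_eq_mul, mul_one]
  have hR : R.degree < P.degree := by
    rw [degree_eq_natDegree hP.ne_zero, hPdeg]
    refine (degree_sum_le _ _).trans_lt ((Finset.sup_lt_iff (by exact WithBot.bot_lt_coe _)).2 ?_)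
    intro b hb
    refine (degree_mul_le _ _).trans_lt ?_
    refine (add_le_of_nonpos_left degree_C_le).trans_lt ?_
    have hm : (∏ i ∈ (S.erase a).erase b, (X + C (l i))).Monic :=
      monic_prod_of_monic _ _ fun b _ ↦ monic_X_add_C _
    rw [degree_eq_natDegree hm.ne_zero, natDegree_prod_of_monic _ _ fun b _ ↦ monic_X_add_C _]
    simp only [natDegree_X_add_C, sum_const, smul_eq_mul, mul_one, Nat.cast_lt]
    exact Finset.card_lt_card (Finset.erase_ssubset hb)
  have hlead : (R + C (c a) * P).leadingCoeff = c a := by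
    rw [leadingCoeff_add_of_degree_lt, leadingCoeff_mul, leadingCoeff_C, hP.leadingCoeff, mul_one]
    rwa [degree_C_mul hca]
  have hfac : ∀ b ∈ S.erase a,
      (L : ℂ) * (σ + a)⁻¹ + l b = l b * (σ + b) * (σ + a)⁻¹ := fun b hb ↦ by
    have : (L : ℂ) = (b - a) * l b := by
      have := hl b hb
      exact_mod_cast this.symm
    rw [this]
    field_simp
    ring
  have hroot : aeval ((L : ℂ) * (σ + a)⁻¹) (R + C (c a) * P) = 0 := by
    have h1 : aeval ((L : ℂ) * (σ + a)⁻¹) P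
        = ∏ b ∈ S.erase a, (l b * (σ + b) * (σ + a)⁻¹) := by
      simp only [P, map_prod, map_add, aeval_X, eq_intCast, map_intCast]
      exact prod_congr rfl hfac
    have h2 : aeval ((L : ℂ) * (σ + a)⁻¹) R
        = (∑ b ∈ S.erase a, c b * (σ + b)⁻¹) * (σ + a) *
          ∏ b ∈ S.erase a, (l b * (σ + b) * (σ + a)⁻¹) := by
      simp only [R, map_sum, map_mul, map_prod, map_add, aeval_X, eq_intCast,
        map_intCast, sum_mul]
      refine sum_congr rfl fun b hb ↦ ?_
      rw [prod_congr rfl fun i hi ↦ hfac i (mem_of_mem_erase hi),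
        ← mul_prod_erase _ _ hb]
      have hbσ := hS b (mem_of_mem_erase hb)
      field_simp
    have h3 : c a * (σ + a)⁻¹ + ∑ b ∈ S.erase a, c b * (σ + b)⁻¹ = 0 := by
      rw [add_sum_erase S (fun v : ℕ ↦ (c v : ℂ) * (σ + v)⁻¹) ha, hsum]
    have h4 : (∑ b ∈ S.erase a, c b * (σ + b)⁻¹) * (σ + a) = -c a := by
      rw [eq_neg_of_add_eq_zero_right h3]
      field_simp
    rw [map_add, map_mul, h1, h2, h4, aeval_C, algebraMap_int_eq, eq_intCast]
    ring
  rw [shiftDenom_dvd_iff]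
  have := isIntegral_leadingCoeff_smul (R + C (c a) * P) _ hroot
  rw [hlead, zsmul_eq_mul] at this
  refine (congrArg (IsIntegral ℤ) ?_).mpr this
  push_cast
  ring

open IntermediateField Polynomial in
theorem finrank_adjoin_le_card_of_sum_inv_eq_zero {σ : ℂ} {S : Finset ℕ} {c : ℕ → ℤ}
    (hS : ∀ v ∈ S, σ + v ≠ 0) (hsum : ∑ v ∈ S, c v * (σ + v)⁻¹ = 0) {a : ℕ} (ha : a ∈ S)
    (hca : c a ≠ 0) : IsIntegral ℚ σ ∧ Module.finrank ℚ ℚ⟮σ⟯ ≤ #S := by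
  let P : ℚ[X] := ∑ v ∈ S, C (c v : ℚ) * ∏ w ∈ S.erase v, (X + C (w : ℚ))
  have hP0 : P ≠ 0 := by
    intro h
    have h1 : P.eval (-(a : ℚ)) = c a * ∏ w ∈ S.erase a, (-a + w : ℚ) := by
      simp only [P, eval_finsetSum, eval_mul, eval_C, eval_prod, eval_add, eval_X]
      refine sum_eq_single_of_mem a ha fun b hb hba ↦ ?_
      rw [prod_eq_zero (mem_erase.2 ⟨hba.symm, ha⟩) (by simp), mul_zero]
    rw [h, eval_zero, eq_comm, mul_eq_zero, prod_eq_zero_iff] at h1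
    rcases h1 with h1 | ⟨w, hw, h1⟩
    · exact hca (by exact_mod_cast h1)
    · refine (mem_erase.1 hw).1 ?_
      have : (w : ℚ) = a := by linarith
      exact_mod_cast this
  have hroot : aeval σ P = 0 := by
    have : aeval σ P = (∑ v ∈ S, c v * (σ + v)⁻¹) * ∏ w ∈ S, (σ + w) := by
      simp only [P, map_sum, map_mul, map_prod, map_add, aeval_X, aeval_C, sum_mul]
      refine sum_congr rfl fun v hv ↦ ?_
      rw [← mul_prod_erase _ _ hv]
      have := hS v hv
      simp only [map_intCast, map_natCast]
      field_simp
    rw [this, hsum, zero_mul]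
  have hint : IsIntegral ℚ σ := IsAlgebraic.isIntegral ⟨P, hP0, hroot⟩
  refine ⟨hint, ?_⟩
  rw [adjoin.finrank hint]
  refine (natDegree_le_of_dvd (minpoly.dvd ℚ σ hroot) hP0).trans ?_
  refine natDegree_sum_le_of_forall_le _ _ fun v hv ↦ ?_
  refine (natDegree_C_mul_le _ _).trans ?_
  rw [natDegree_prod_of_monic _ _ fun b _ ↦ monic_X_add_C _]
  simpa only [natDegree_X_add_C, sum_const, smul_eq_mul, mul_one] using card_erase_le (s := S)

open IntermediateField in
/-- Modulo a prime power dividing all the denominators, the shifts fall into few classes. -/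
theorem card_image_mod_le_finrank {σ : ℂ} (hσ : IsIntegral ℚ σ) {V : Finset ℕ}
    (hV : ∀ v ∈ V, σ + v ≠ 0) {p k : ℕ} (hp : p.Prime) (hk : k ≠ 0)
    (hdvd : ∀ v ∈ V, p ^ k ∣ shiftDenom σ v) :
    #(V.image (· % p ^ k)) ≤ Module.finrank ℚ ℚ⟮σ⟯ := by
  have := adjoin.finiteDimensional hσ
  by_contra! hcard
  obtain ⟨W, hWV, hWinj, hWim⟩ := Finset.exists_subset_injOn_image_eq_of_surjOn V
    (V.image (· % p ^ k)) (f := (· % p ^ k)) (by rw [Finset.coe_image]; exact Set.surjOn_image _ _)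
  rw [← hWim, Finset.card_image_of_injOn hWinj] at hcard
  have hdep : ¬ LinearIndependent ℚ fun w : W ↦ (AdjoinSimple.gen ℚ σ + (w : ℕ))⁻¹ := by
    intro h
    have := h.fintype_card_le_finrank
    rw [Fintype.card_coe] at this
    omega
  rw [← LinearIndependent.iff_fractionRing ℤ ℚ, Fintype.not_linearIndependent_iff] at hdep
  obtain ⟨g, hg, w₀, hw₀⟩ := hdep
  obtain ⟨g', hg', hgcd⟩ := Finset.extract_gcd g (⟨w₀, mem_univ _⟩ : univ.Nonempty)
  have hgcd0 : univ.gcd g ≠ 0 := fun h ↦ hw₀ (by rw [hg' w₀ (mem_univ _), h, zero_mul])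
  obtain ⟨a, ha⟩ : ∃ a, ¬ (p : ℤ) ∣ g' a := by
    by_contra! h
    have : (p : ℤ) ∣ univ.gcd g' := Finset.dvd_gcd fun b _ ↦ h b
    rw [hgcd] at this
    exact hp.one_lt.ne' (by exact_mod_cast Int.eq_one_of_dvd_one (by positivity) this)
  let c : ℕ → ℤ := fun n ↦ if h : n ∈ W then g' ⟨n, h⟩ else 0
  have hc : ∀ w : W, c w = g' w := fun w ↦ by simp [c]
  have hsum : ∑ v ∈ W, c v * (σ + v)⁻¹ = 0 := by
    rw [← Finset.sum_coe_sort]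
    have h1 := congrArg (algebraMap ℚ⟮σ⟯ ℂ) hg
    simp only [hg' _ (mem_univ _), mul_smul] at h1
    rw [← Finset.smul_sum, map_zsmul, map_zero, smul_eq_zero_iff_right hgcd0, map_sum] at h1
    rw [← h1]
    refine sum_congr rfl fun w _ ↦ ?_
    rw [hc, map_zsmul, zsmul_eq_mul, map_inv₀, map_add, AdjoinSimple.algebraMap_gen, map_natCast]
  have hdiv := shiftDenom_dvd_mul_lcm (fun v hv ↦ hV v (hWV hv)) hsum a.2
  have hpc : IsCoprime ((p : ℤ) ^ k) (c a) := by
    rw [hc]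
    exact ((Nat.prime_iff_prime_int.1 hp).coprime_iff_not_dvd.2 ha).pow_left
  have hpk : ((p : ℤ) ^ k) ∣ shiftDenom σ a := by exact_mod_cast hdvd a (hWV a.2)
  have hpl := hpc.dvd_of_dvd_mul_left (hpk.trans hdiv)
  obtain ⟨b, hb, hpb⟩ := hp.pow_dvd_finset_lcm hk
    (Int.natCast_dvd_natCast.1 (by rw [Nat.cast_pow]; exact hpl))
  rw [mem_erase] at hb
  refine hb.1 (hWinj hb.2 a.2 ?_)
  refine (Nat.modEq_iff_dvd.2 ?_ : (a : ℕ) ≡ b [MOD p ^ k]).symm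
  exact Int.natCast_dvd.2 hpb

open IntermediateField Polynomial in
theorem card_le_of_modEq_of_shiftDenom_eq {σ : ℂ} (hσ : IsIntegral ℚ σ) {V : Finset ℕ}
    (hV : ∀ v ∈ V, σ + v ≠ 0) {n : ℕ} (hden : ∀ v ∈ V, shiftDenom σ v = n)
    (hmod : ∀ v ∈ V, ∀ w ∈ V, v ≡ w [MOD n]) :
    #V ≤ 2 * Module.finrank ℚ ℚ⟮σ⟯ := by
  have := adjoin.finiteDimensional hσ
  rcases V.eq_empty_or_nonempty with rfl | ⟨a, ha⟩
  · simp
  let θ := AdjoinSimple.gen ℚ σ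
  have hθ : ∀ v : ℕ, algebraMap ℚ⟮σ⟯ ℂ (θ + v) = σ + v := fun v ↦ by
    rw [map_add, AdjoinSimple.algebraMap_gen, map_natCast]
  have hθ0 : ∀ v ∈ V, θ + v ≠ 0 := fun v hv h ↦ hV v hv (by rw [← hθ, h, map_zero])
  have hquot : ∀ v ∈ V, ∀ w ∈ V, IsIntegral ℤ ((θ + v) / (θ + w)) := fun v hv w hw ↦ by
    rw [← isIntegral_algebraMap_iff (algebraMap ℚ⟮σ⟯ ℂ).injective, map_div₀, hθ, hθ]
    obtain ⟨e, he⟩ := (hmod w hw v hv).dvd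
    have h1 : IsIntegral ℤ (((shiftDenom σ w : ℤ) : ℂ) * (σ + w)⁻¹) :=
      shiftDenom_dvd_iff.1 dvd_rfl
    rw [hden w hw] at h1
    have h2 := (isIntegral_one (R := ℤ)).add ((isIntegral_algebraMap (R := ℤ) (x := e)).mul h1)
    refine (congrArg (IsIntegral ℤ) ?_).mpr h2
    have h3 : (v : ℂ) = w + n * e := by
      have : (v : ℤ) = w + n * e := by linarith
      exact_mod_cast this
    have hw0 := hV w hw
    rw [h3]
    simp only [algebraMap_int_eq, eq_intCast, Int.cast_natCast]
    field_simp
    ring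
  let ν : ℚ⟮σ⟯ → ℚ := Algebra.norm ℚ
  have hν : ∀ v ∈ V, ν (θ + v) = ν (θ + a) ∨ ν (θ + v) = -ν (θ + a) := fun v hv ↦ by
    obtain ⟨i, hi⟩ := IsIntegrallyClosed.isIntegral_iff.1
      (Algebra.isIntegral_norm ℚ (hquot v hv a ha))
    obtain ⟨j, hj⟩ := IsIntegrallyClosed.isIntegral_iff.1
      (Algebra.isIntegral_norm ℚ (hquot a ha v hv))
    have hva := hθ0 v hv
    have haa := hθ0 a ha
    have hij : (i : ℚ) * j = 1 := by
      simp only [algebraMap_int_eq, eq_intCast] at hi hj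
      rw [hi, hj, ← map_mul, div_mul_div_cancel₀ haa, div_self hva, map_one]
    have hvi : ν (θ + v) = i * ν (θ + a) := by
      simp only [algebraMap_int_eq, eq_intCast] at hi
      simp only [ν]
      rw [hi, ← map_mul, div_mul_cancel₀ _ haa]
    rcases Int.eq_one_or_neg_one_of_mul_eq_one (by exact_mod_cast hij : i * j = 1) with rfl | rfl
    · left; simpa using hvi
    · right; simpa using hvi
  let P : ℚ[X] := (Algebra.lmul ℚ ℚ⟮σ⟯ (-θ)).charpoly
  have hPm : P.Monic := LinearMap.charpoly_monic _
  have hPdeg : P.natDegree = Module.finrank ℚ ℚ⟮σ⟯ := LinearMap.charpoly_natDegree _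
  have hPpos : 0 < P.natDegree := by rw [hPdeg]; exact Module.finrank_pos
  have hPeval : ∀ v : ℕ, P.eval (v : ℚ) = ν (θ + v) := fun v ↦ by
    simp only [P, ν]
    rw [LinearMap.eval_charpoly, Algebra.norm_apply]
    congr 1
    rw [map_natCast, ← map_natCast (Algebra.lmul ℚ ℚ⟮σ⟯), ← map_sub, sub_neg_eq_add, add_comm]
  let Q : ℚ[X] := (P - C (ν (θ + a))) * (P + C (ν (θ + a)))
  have hPC : (C (ν (θ + a))).degree < P.degree :=
    degree_C_le.trans_lt (natDegree_pos_iff_degree_pos.1 hPpos)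
  have hQm : Q.Monic := (hPm.sub_of_left hPC).mul (hPm.add_of_left hPC)
  have hQdeg : Q.natDegree ≤ 2 * Module.finrank ℚ ℚ⟮σ⟯ := by
    refine natDegree_mul_le.trans ?_
    rw [natDegree_sub_C, natDegree_add_C, hPdeg, two_mul]
  calc #V = #(V.image (Nat.cast : ℕ → ℚ)) :=
        (card_image_of_injective _ Nat.cast_injective).symm
    _ ≤ #Q.roots.toFinset := by
        refine card_le_card fun x hx ↦ ?_
        obtain ⟨v, hv, rfl⟩ := mem_image.1 hx
        rw [Multiset.mem_toFinset, mem_roots hQm.ne_zero, IsRoot.def]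
        simp only [Q, eval_mul, eval_sub, eval_add, eval_C, hPeval]
        rcases hν v hv with h | h <;> rw [h] <;> ring
    _ ≤ Q.natDegree := (Multiset.toFinset_card_le _).trans (card_roots' _)
    _ ≤ _ := hQdeg

open IntermediateField in
theorem card_le_of_shiftDenom_eq {σ : ℂ} (hσ : IsIntegral ℚ σ) {V : Finset ℕ}
    (hV : ∀ v ∈ V, σ + v ≠ 0) {n : ℕ} (hn : n ≠ 0) (hden : ∀ v ∈ V, shiftDenom σ v = n) :
    #V ≤ 2 * Module.finrank ℚ ℚ⟮σ⟯ * ∏ _p ∈ n.primeFactors, Module.finrank ℚ ℚ⟮σ⟯ := by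
  let f : ℕ → (p : ℕ) → p ∈ n.primeFactors → ℕ := fun v p _ ↦ v % p ^ n.factorization p
  let t : ℕ → Finset ℕ := fun p ↦ V.image (· % p ^ n.factorization p)
  have hf : ∀ v ∈ V, f v ∈ n.primeFactors.pi t := fun v hv ↦
    Finset.mem_pi.2 fun p _ ↦ mem_image_of_mem _ hv
  refine (card_le_mul_card_image_of_maps_to hf (2 * Module.finrank ℚ ℚ⟮σ⟯) ?_).trans ?_
  · intro g _
    refine card_le_of_modEq_of_shiftDenom_eq hσ (fun v hv ↦ hV v (mem_filter.1 hv).1)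
      (fun v hv ↦ hden v (mem_filter.1 hv).1) fun v hv w hw ↦ ?_
    have hvw : f v = f w := (mem_filter.1 hv).2.trans (mem_filter.1 hw).2.symm
    rw [Nat.modEq_iff_dvd, Int.natCast_dvd, Nat.dvd_iff_prime_pow_dvd_dvd]
    intro p k hp hpk
    rcases eq_or_ne k 0 with rfl | hk
    · simp
    have hpn : p ∈ n.primeFactors :=
      Nat.mem_primeFactors.2 ⟨hp, (dvd_pow_self p hk).trans hpk, hn⟩
    have h1 : v ≡ w [MOD p ^ n.factorization p] := congrFun (congrFun hvw p) hpn
    exact (pow_dvd_pow p ((hp.pow_dvd_iff_le_factorization hn).1 hpk)).trans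
      (Int.natCast_dvd.1 h1.dvd)
  · rw [card_pi]
    refine Nat.mul_le_mul_left _ (prod_le_prod' fun p hp ↦ ?_)
    have hp' := Nat.mem_primeFactors.1 hp
    refine card_image_mod_le_finrank hσ hV hp'.1 (hp'.1.factorization_pos_of_dvd hn hp'.2.1).ne'
      fun v hv ↦ ?_
    rw [hden v hv]
    exact Nat.ordProj_dvd n p

theorem exists_prod_primeFactors_le_rpow {D : ℕ} (hD : 1 ≤ D) {ε : ℝ} (hε : 0 < ε) :
    ∃ C : ℝ, 1 ≤ C ∧ ∀ n : ℕ, n ≠ 0 →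
      ((∏ p ∈ n.primeFactors, D * (n.factorization p + 1) : ℕ) : ℝ) ≤ C * (n : ℝ) ^ ε := by
  set δ : ℝ := 2 ^ ε - 1 with hδ
  have hδ0 : 0 < δ := sub_pos.2 (Real.one_lt_rpow (by norm_num) hε)
  have hD' : (1 : ℝ) ≤ D := by exact_mod_cast hD
  set K : ℝ := D * (1 + 1 / δ) with hK
  have hK1 : 1 ≤ K := by
    have : 0 < 1 / δ := by positivity
    nlinarith
  obtain ⟨P, hP⟩ := exists_nat_ge ((2 * D : ℝ) ^ ε⁻¹)
  refine ⟨K ^ P, one_le_pow₀ hK1, fun n hn ↦ ?_⟩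
  have hnprod : (n : ℝ) ^ ε = ∏ p ∈ n.primeFactors, ((p : ℝ) ^ ε) ^ n.factorization p := by
    conv_lhs => rw [← Nat.prod_factorization_pow_eq_self hn]
    rw [Finsupp.prod, Nat.cast_prod, ← Real.finsetProd_rpow _ _ (fun _ _ ↦ by positivity)]
    refine prod_congr (Nat.support_factorization n) fun p _ ↦ ?_
    rw [Nat.cast_pow, ← Real.rpow_natCast, ← Real.rpow_natCast, ← Real.rpow_mul (by positivity),
      ← Real.rpow_mul (by positivity), mul_comm]
  have hfac : ∀ p ∈ n.primeFactors, ((D * (n.factorization p + 1) : ℕ) : ℝ) ≤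
      (if p < P then K else 1) * ((p : ℝ) ^ ε) ^ n.factorization p := fun p hp ↦ by
    obtain ⟨hpp, hpn, -⟩ := Nat.mem_primeFactors.1 hp
    have hv : n.factorization p ≠ 0 := (hpp.factorization_pos_of_dvd hn hpn).ne'
    set v := n.factorization p
    push_cast
    split_ifs with hpP
    · have h1 : (1 + v * δ : ℝ) ≤ ((p : ℝ) ^ ε) ^ v := calc
        (1 + v * δ : ℝ) ≤ (1 + δ) ^ v := one_add_mul_le_pow (by linarith) v
        _ = ((2 : ℝ) ^ ε) ^ v := by rw [hδ]; ring
        _ ≤ ((p : ℝ) ^ ε) ^ v := by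
          gcongr
          exact_mod_cast hpp.two_le
      refine le_trans ?_ (mul_le_mul_of_nonneg_left h1 (by positivity))
      have : K * (1 + v * δ) = D * (v + 1) + D * (v * δ + 1 / δ) := by
        rw [hK]; field_simp; ring
      rw [this]
      have : (0 : ℝ) ≤ D * (v * δ + 1 / δ) := by positivity
      linarith
    · have h1 : (2 * D : ℝ) ≤ (p : ℝ) ^ ε := by
        calc (2 * D : ℝ) = ((2 * D : ℝ) ^ ε⁻¹) ^ ε := by
              rw [← Real.rpow_mul (by positivity), inv_mul_cancel₀ hε.ne', Real.rpow_one]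
          _ ≤ (p : ℝ) ^ ε := by
            gcongr
            exact hP.trans (by exact_mod_cast not_lt.1 hpP)
      calc (D * (v + 1) : ℝ) ≤ D ^ v * 2 ^ v := by
            gcongr
            · exact le_self_pow₀ hD' hv
            · exact_mod_cast Nat.lt_two_pow_self
        _ = (2 * D) ^ v := by rw [mul_pow, mul_comm]
        _ ≤ ((p : ℝ) ^ ε) ^ v := by gcongr
        _ = _ := (one_mul _).symm
  rw [hnprod, Nat.cast_prod]
  refine (prod_le_prod (fun _ _ ↦ by positivity) hfac).trans ?_
  rw [prod_mul_distrib]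
  gcongr
  rw [prod_ite, prod_const_one, mul_one, prod_const]
  refine pow_le_pow_right₀ hK1 ?_
  calc _ ≤ #(range P) := card_le_card fun p hp ↦ mem_range.2 (mem_filter.1 hp).2
    _ = P := card_range P

/-- The weight of `a` relative to the set `S` of other members of a tuple: morally the reciprocal
of the number of candidates for `a` once `S` and the gcds of `q a` with the differences are known.
The members of `G` are those for which `q` is under control. -/
noncomputable def weight (q : ℕ → ℕ) (G : Finset ℕ) (N a : ℕ) (S : Finset ℕ) : ℝ :=
  if a ∈ G then
    min 1 (((S.filter (· ∈ G)).lcm (fun b ↦ (q a).gcd ((b : ℤ) - a).natAbs) : ℕ) /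
      (min N (q a) : ℕ))
  else if a ∈ S then 1 else 1 / N

theorem weight_nonneg (q : ℕ → ℕ) (G : Finset ℕ) (N a : ℕ) (S : Finset ℕ) :
    0 ≤ weight q G N a S := by
  unfold weight
  split_ifs <;> positivity

theorem card_le_div_add_one_of_modEq {N A : ℕ} {F : Finset ℕ} (hF : F ⊆ Icc 1 N)
    (hmod : ∀ a ∈ F, ∀ b ∈ F, a ≡ b [MOD A]) : #F ≤ N / A + 1 := by
  rw [← card_range (N / A + 1)]
  refine card_le_card_of_injOn (· / A) (fun a ha ↦ ?_) fun a ha b hb hab ↦ ?_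
  · have := (mem_Icc.1 (hF ha)).2
    exact mem_coe.2 (mem_range.2 (Nat.lt_succ_of_le (Nat.div_le_div_right this)))
  · have h1 : a % A = b % A := hmod a ha b hb
    have h2 : a / A = b / A := hab
    rw [← Nat.div_add_mod a A, ← Nat.div_add_mod b A, h1, h2]

theorem sum_div_le_of_card_fiber_le {q : ℕ → ℕ} {F : Finset ℕ} {X A : ℕ} {M : ℝ}
    (hq : ∀ a ∈ F, 0 < q a ∧ q a ≤ X) (hcount : ∀ n ≠ 0, (#(F.filter (q · = n)) : ℝ) ≤ M)
    (hM : 0 ≤ M) (hA : ∀ a ∈ F, A ∣ q a) :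
    ∑ a ∈ F, (A : ℝ) / q a ≤ M * (1 + Real.log X) := by
  have hmaps : ∀ a ∈ F, q a / A ∈ Icc 1 X := fun a ha ↦ by
    obtain ⟨h1, h2⟩ := hq a ha
    have := Nat.pos_of_dvd_of_pos (hA a ha) h1
    exact mem_Icc.2 ⟨Nat.div_pos (Nat.le_of_dvd h1 (hA a ha)) this,
      (Nat.div_le_self _ _).trans h2⟩
  rw [← sum_fiberwise_of_maps_to hmaps]
  calc _ ≤ ∑ m ∈ Icc 1 X, M * (m : ℝ)⁻¹ := sum_le_sum fun m hm ↦ ?_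
    _ = M * harmonic X := by
      rw [← mul_sum, harmonic_eq_sum_Icc]
      push_cast
      rfl
    _ ≤ _ := by gcongr; exact harmonic_le_one_add_log X
  have hm1 := (mem_Icc.1 hm).1
  rcases (F.filter (q · / A = m)).eq_empty_or_nonempty with h | ⟨a₀, ha₀⟩
  · rw [h, sum_empty]; positivity
  have hA0 : 0 < A := by
    have := (mem_filter.1 ha₀).1
    exact Nat.pos_of_dvd_of_pos (hA _ this) (hq _ this).1
  have heq : ∀ a ∈ F.filter (q · / A = m), q a = A * m := fun a ha ↦ by
    obtain ⟨h1, h2⟩ := mem_filter.1 ha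
    rw [← h2, Nat.mul_div_cancel' (hA a h1)]
  calc _ = ∑ a ∈ F.filter (q · / A = m), (m : ℝ)⁻¹ := sum_congr rfl fun a ha ↦ by
        rw [heq a ha]; push_cast; field_simp
    _ = #(F.filter (q · / A = m)) * (m : ℝ)⁻¹ := by rw [sum_const, nsmul_eq_mul]
    _ ≤ M * (m : ℝ)⁻¹ := by
      gcongr
      refine le_trans ?_ (hcount (A * m) (by positivity))
      exact_mod_cast card_le_card fun a ha ↦ mem_filter.2 ⟨(mem_filter.1 ha).1, heq a ha⟩

theorem sum_weight_le {q : ℕ → ℕ} {G : Finset ℕ} {N X : ℕ} {M : ℝ} (hN : 0 < N)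
    (hG : G ⊆ Icc 1 N) (hq : ∀ a ∈ G, 0 < q a ∧ q a ≤ X)
    (hgcd : ∀ a ∈ G, ∀ b ∈ G, (q a).gcd ((b : ℤ) - a).natAbs ∣ q b)
    (hM : 1 ≤ M) (hcount : ∀ n ≠ 0, (#(G.filter (q · = n)) : ℝ) ≤ M)
    (hdiv : ∀ a ∈ G, (#(q a).divisors : ℝ) ≤ M) (S : Finset ℕ) :
    ∑ a ∈ Icc 1 N, weight q G N a S ≤ #S + 1 + M ^ #S * (2 + M * (1 + Real.log X)) := by
  have hN' : (0 : ℝ) < N := by exact_mod_cast hN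
  have hlog : 0 ≤ Real.log X := Real.log_natCast_nonneg X
  rw [← sum_sdiff hG]
  refine add_le_add ?_ ?_
  · calc _ ≤ ∑ a ∈ Icc 1 N \ G, ((if a ∈ S then 1 else 0) + 1 / (N : ℝ)) :=
          sum_le_sum fun a ha ↦ by
            have : 0 < 1 / (N : ℝ) := by positivity
            rw [weight, if_neg (mem_sdiff.1 ha).2]
            split_ifs <;> linarith
      _ ≤ ∑ a ∈ Icc 1 N \ G, (if a ∈ S then 1 else 0) + ∑ a ∈ Icc 1 N, 1 / (N : ℝ) := by
          rw [sum_add_distrib]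
          gcongr
          exact sdiff_subset
      _ ≤ #S + 1 := by
          refine add_le_add ?_ ?_
          · rw [sum_boole]
            exact_mod_cast card_le_card fun a ha ↦ (mem_filter.1 ha).2
          · simp [hN'.ne']
  set T := S.filter (· ∈ G) with hT
  have hTG : ∀ b ∈ T, b ∈ G := fun b hb ↦ (mem_filter.1 hb).2
  let f : ℕ → (b : ℕ) → b ∈ T → ℕ := fun a b _ ↦ (q a).gcd ((b : ℤ) - a).natAbs
  have hf : ∀ a ∈ G, f a ∈ T.pi fun b ↦ (q b).divisors := fun a ha ↦
    Finset.mem_pi.2 fun b hb ↦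
      Nat.mem_divisors.2 ⟨hgcd a ha b (hTG b hb), (hq b (hTG b hb)).1.ne'⟩
  rw [← sum_fiberwise_of_maps_to hf]
  have hB : 0 ≤ 2 + M * (1 + Real.log X) := by positivity
  have hfiber : ∀ g ∈ T.pi fun b ↦ (q b).divisors,
      ∑ a ∈ G.filter (f · = g), weight q G N a S ≤ 2 + M * (1 + Real.log X) := fun g _ ↦ by
    set F := G.filter (f · = g) with hF
    have hFG : F ⊆ G := filter_subset _ _
    rcases F.eq_empty_or_nonempty with h | ⟨a₀, ha₀⟩
    · rw [h, sum_empty]; exact hB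
    set A := T.lcm fun b ↦ (q a₀).gcd ((b : ℤ) - a₀).natAbs with hA
    have hff : ∀ a ∈ F, ∀ b ∈ T,
        (q a).gcd ((b : ℤ) - a).natAbs = (q a₀).gcd ((b : ℤ) - a₀).natAbs := fun a ha b hb ↦
      congrFun (congrFun ((mem_filter.1 ha).2.trans (mem_filter.1 ha₀).2.symm) b) hb
    have hAa : ∀ a ∈ F, T.lcm (fun b ↦ (q a).gcd ((b : ℤ) - a).natAbs) = A := fun a ha ↦
      Finset.lcm_congr rfl (hff a ha)
    have hAq : ∀ a ∈ F, A ∣ q a := fun a ha ↦ by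
      rw [← hAa a ha]
      exact Finset.lcm_dvd fun b _ ↦ Nat.gcd_dvd_left _ _
    have hA0 : 0 < A := Nat.pos_of_dvd_of_pos (hAq a₀ ha₀) (hq a₀ (hFG ha₀)).1
    have hA0' : (0 : ℝ) < A := by exact_mod_cast hA0
    have hmod : ∀ a ∈ F, a ≡ a₀ [MOD A] := fun a ha ↦ by
      rw [Nat.modEq_iff_dvd, Int.natCast_dvd]
      refine Finset.lcm_dvd fun b hb ↦ ?_
      have h1 : (((q a₀).gcd ((b : ℤ) - a₀).natAbs : ℕ) : ℤ) ∣ (b : ℤ) - a₀ :=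
        Int.natCast_dvd.2 (Nat.gcd_dvd_right _ _)
      have h2 : (((q a₀).gcd ((b : ℤ) - a₀).natAbs : ℕ) : ℤ) ∣ (b : ℤ) - a := by
        rw [← hff a ha b hb]
        exact Int.natCast_dvd.2 (Nat.gcd_dvd_right _ _)
      refine Int.natCast_dvd.1 ?_
      have := dvd_sub h2 h1
      rwa [sub_sub_sub_cancel_left] at this
    have hcard : (#F : ℝ) ≤ N / A + 1 := by
      have := card_le_div_add_one_of_modEq (hFG.trans hG)
        fun a ha b hb ↦ (hmod a ha).trans (hmod b hb).symm
      calc (#F : ℝ) ≤ ((N / A : ℕ) : ℝ) + 1 := by exact_mod_cast this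
        _ ≤ N / A + 1 := by gcongr; exact Nat.cast_div_le
    calc ∑ a ∈ F, weight q G N a S
        ≤ ∑ a ∈ F, (min 1 ((A : ℝ) / N) + A / q a) := sum_le_sum fun a ha ↦ by
          have hqa : (0 : ℝ) < q a := by exact_mod_cast (hq a (hFG ha)).1
          rw [weight, if_pos (hFG ha), ← hT, hAa a ha]
          rcases le_total N (q a) with h | h
          · rw [min_eq_left h]
            have : 0 ≤ (A : ℝ) / q a := by positivity
            linarith
          · rw [min_eq_right h]
            have : 0 ≤ min 1 ((A : ℝ) / N) := by positivity
            linarith [min_le_right 1 ((A : ℝ) / q a)]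
      _ = #F * min 1 ((A : ℝ) / N) + ∑ a ∈ F, (A : ℝ) / q a := by
          rw [sum_add_distrib, sum_const, nsmul_eq_mul]
      _ ≤ 2 + M * (1 + Real.log X) := by
          refine add_le_add ?_ (sum_div_le_of_card_fiber_le (fun a ha ↦ hq a (hFG ha))
            (fun n hn ↦ le_trans ?_ (hcount n hn)) (by linarith) hAq)
          · calc #F * min 1 ((A : ℝ) / N) ≤ (N / A + 1) * min 1 ((A : ℝ) / N) := by gcongr
              _ = N / A * min 1 ((A : ℝ) / N) + min 1 ((A : ℝ) / N) := by ring
              _ ≤ N / A * ((A : ℝ) / N) + 1 := by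
                gcongr
                · exact min_le_right _ _
                · exact min_le_left _ _
              _ = 2 := by field_simp; norm_num
          · exact_mod_cast card_le_card (filter_subset_filter _ hFG)
  calc _ ≤ ∑ _g ∈ T.pi fun b ↦ (q b).divisors, (2 + M * (1 + Real.log X)) := sum_le_sum hfiber
    _ = (∏ b ∈ T, (#(q b).divisors : ℝ)) * (2 + M * (1 + Real.log X)) := by
        rw [sum_const, card_pi, nsmul_eq_mul, Nat.cast_prod]
    _ ≤ M ^ #S * (2 + M * (1 + Real.log X)) := by
        gcongr
        calc _ ≤ ∏ b ∈ T, M :=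
              prod_le_prod (fun _ _ ↦ by positivity) fun b hb ↦ hdiv b (hTG b hb)
          _ = M ^ #T := prod_const _
          _ ≤ M ^ #S := pow_le_pow_right₀ hM (card_le_card (filter_subset _ _))

theorem sum_piFinset_prod_Ioi_le {φ : ℕ → Finset ℕ → ℝ} (hφ : ∀ a S, 0 ≤ φ a S) {V : Finset ℕ}
    {m : ℕ} {K : ℝ} (hK0 : 0 ≤ K) (hK : ∀ S, #S ≤ m → ∑ a ∈ V, φ a S ≤ K) {n : ℕ} (hn : n ≤ m) :
    ∑ x ∈ Fintype.piFinset fun _ : Fin n ↦ V, ∏ k, φ (x k) ((Ioi k).image x) ≤ K ^ n := by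
  induction n with
  | zero => simp
  | succ n ih =>
    have hstep : ∑ x ∈ Fintype.piFinset fun _ : Fin (n + 1) ↦ V, ∏ k, φ (x k) ((Ioi k).image x) =
        ∑ y ∈ Fintype.piFinset fun _ : Fin n ↦ V, (∑ a ∈ V, φ a (univ.image y)) *
          ∏ k, φ (y k) ((Ioi k).image y) := by
      simp_rw [sum_mul]
      rw [← sum_product']
      refine sum_nbij' (fun x ↦ (Fin.tail x, x 0)) (fun p ↦ Fin.cons p.2 p.1) ?_ ?_ ?_ ?_ ?_
      · intro x hx
        rw [Fintype.mem_piFinset] at hx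
        exact mem_product.2 ⟨Fintype.mem_piFinset.2 fun i ↦ hx _, hx 0⟩
      · intro p hp
        rw [mem_product, Fintype.mem_piFinset] at hp
        exact Fintype.mem_piFinset.2 fun i ↦ by
          refine Fin.cases ?_ (fun j ↦ ?_) i
          · simpa using hp.2
          · simpa using hp.1 j
      · intro x _; simp
      · intro p _; simp
      · intro x _
        rw [Fin.prod_univ_succ]
        congr 1
        · congr 1
          ext v
          simp [Fin.exists_fin_succ, Fin.tail]
        · refine prod_congr rfl fun k _ ↦ ?_
          congr 1
          ext v
          simp [Fin.exists_fin_succ, Fin.tail]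
    rw [hstep, pow_succ']
    calc _ ≤ ∑ y ∈ Fintype.piFinset fun _ : Fin n ↦ V, K * ∏ k, φ (y k) ((Ioi k).image y) := by
          refine sum_le_sum fun y _ ↦ mul_le_mul_of_nonneg_right (hK _ ?_)
            (prod_nonneg fun _ _ ↦ hφ _ _)
          exact card_image_le.trans (by simp; omega)
      _ ≤ K * K ^ n := by
          rw [← mul_sum]
          exact mul_le_mul_of_nonneg_left (ih (by omega)) hK0

theorem sum_piFinset_prod_Iio_le {φ : ℕ → Finset ℕ → ℝ} (hφ : ∀ a S, 0 ≤ φ a S) {V : Finset ℕ}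
    {m : ℕ} {K : ℝ} (hK0 : 0 ≤ K) (hK : ∀ S, #S ≤ m → ∑ a ∈ V, φ a S ≤ K) :
    ∑ x ∈ Fintype.piFinset fun _ : Fin m ↦ V, ∏ k, φ (x k) ((Iio k).image x) ≤ K ^ m := by
  refine le_of_eq_of_le ?_ (sum_piFinset_prod_Ioi_le hφ hK0 hK le_rfl)
  refine sum_nbij' (· ∘ Fin.rev) (· ∘ Fin.rev) ?_ ?_ ?_ ?_ ?_
  · intro x hx
    rw [Fintype.mem_piFinset] at hx ⊢
    exact fun i ↦ hx _
  · intro x hx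
    rw [Fintype.mem_piFinset] at hx ⊢
    exact fun i ↦ hx _
  · intro x _; ext; simp
  · intro x _; ext; simp
  · intro x _
    rw [← Equiv.prod_comp Fin.revPerm]
    refine prod_congr rfl fun k _ ↦ ?_
    simp only [Fin.revPerm_apply, Function.comp_apply]
    congr 1
    rw [← image_image]
    congr 1
    ext v
    simp only [mem_Iio, mem_image, mem_Ioi]
    exact ⟨fun h ↦ ⟨v.rev, by rwa [← Fin.rev_lt_rev, Fin.rev_rev], Fin.rev_rev v⟩,
      by rintro ⟨w, hw, rfl⟩; rwa [Fin.rev_lt_rev]⟩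

theorem one_div_le_weight {q : ℕ → ℕ} {G : Finset ℕ} (hq : ∀ a ∈ G, 0 < q a) {N : ℕ} (hN : 0 < N)
    (a : ℕ) (S : Finset ℕ) : 1 / (N : ℝ) ≤ weight q G N a S := by
  have hN' : (1 : ℝ) ≤ N := by exact_mod_cast hN
  have h1 : 1 / (N : ℝ) ≤ 1 := by rw [div_le_one (by linarith)]; exact hN'
  unfold weight
  split_ifs with ha
  · refine le_min h1 ?_
    have hA : 0 < (S.filter (· ∈ G)).lcm fun b ↦ (q a).gcd ((b : ℤ) - a).natAbs :=
      Nat.pos_of_dvd_of_pos (Finset.lcm_dvd fun b _ ↦ Nat.gcd_dvd_left _ _) (hq a ha)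
    have hR : 0 < min N (q a) := lt_min hN (hq a ha)
    gcongr
    · exact_mod_cast hA
    · exact min_le_left _ _
  · exact h1
  · exact le_rfl

theorem weight_eq_one_of_mem {q : ℕ → ℕ} {G : Finset ℕ} (hq : ∀ a ∈ G, 0 < q a) {N : ℕ}
    (hN : 0 < N) {a : ℕ} {S : Finset ℕ} (ha : a ∈ S) : weight q G N a S = 1 := by
  unfold weight
  split_ifs with haG
  · have hA : q a ≤ (S.filter (· ∈ G)).lcm fun b ↦ (q a).gcd ((b : ℤ) - a).natAbs := by
      refine Nat.le_of_dvd (Nat.pos_of_dvd_of_pos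
        (Finset.lcm_dvd fun b _ ↦ Nat.gcd_dvd_left _ _) (hq a haG)) ?_
      have := Finset.dvd_lcm (f := fun b : ℕ ↦ (q a).gcd ((b : ℤ) - a).natAbs)
        (mem_filter.2 ⟨ha, haG⟩)
      simpa using this
    have hR : (0 : ℝ) < (min N (q a) : ℕ) := by exact_mod_cast lt_min hN (hq a haG)
    rw [min_eq_left_iff, one_le_div hR]
    exact_mod_cast (min_le_right _ _).trans hA
  · rfl

theorem one_div_le_weight_mul_weight {q : ℕ → ℕ} {G : Finset ℕ} (hq : ∀ a ∈ G, 0 < q a) {N : ℕ}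
    (hN : 0 < N) {a : ℕ} (ha : a ∈ G) {S T : Finset ℕ}
    (hdvd : q a ∣ ((S ∪ T).filter (· ∈ G)).lcm fun b ↦ (q a).gcd ((b : ℤ) - a).natAbs) :
    1 / (N : ℝ) ≤ weight q G N a S * weight q G N a T := by
  have hS := one_div_le_weight hq hN a S
  have hT := one_div_le_weight hq hN a T
  simp only [weight, if_pos ha] at hS hT ⊢
  set A := (S.filter (· ∈ G)).lcm fun b ↦ (q a).gcd ((b : ℤ) - a).natAbs with hA
  set B := (T.filter (· ∈ G)).lcm fun b ↦ (q a).gcd ((b : ℤ) - a).natAbs with hB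
  have hA0 : 0 < A :=
    Nat.pos_of_dvd_of_pos (Finset.lcm_dvd fun b _ ↦ Nat.gcd_dvd_left _ _) (hq a ha)
  have hB0 : 0 < B :=
    Nat.pos_of_dvd_of_pos (Finset.lcm_dvd fun b _ ↦ Nat.gcd_dvd_left _ _) (hq a ha)
  have hAB : q a ≤ A * B := by
    refine Nat.le_of_dvd (by positivity) (hdvd.trans ?_)
    rw [filter_union, Finset.lcm_union]
    exact lcm_dvd_mul _ _
  have hR : (0 : ℝ) < (min N (q a) : ℕ) := by exact_mod_cast lt_min hN (hq a ha)
  have hRN : ((min N (q a) : ℕ) : ℝ) ≤ N := by exact_mod_cast min_le_left _ _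
  have hRAB : ((min N (q a) : ℕ) : ℝ) ≤ A * B := by exact_mod_cast (min_le_right _ _).trans hAB
  set R : ℝ := ((min N (q a) : ℕ) : ℝ)
  rcases le_total 1 ((A : ℝ) / R) with h1 | h1
  · rwa [min_eq_left h1, one_mul]
  rcases le_total 1 ((B : ℝ) / R) with h2 | h2
  · rwa [min_eq_left h2, mul_one]
  rw [min_eq_right h1, min_eq_right h2]
  calc 1 / (N : ℝ) ≤ 1 / R := by gcongr
    _ = R / (R * R) := by field_simp
    _ ≤ A * B / (R * R) := by gcongr
    _ = _ := by rw [div_mul_div_comm]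

open IntermediateField in
/-- The integers `a ∈ [1, N]` whose denominator `shiftDenom σ a` is at most `X`, provided that `σ`
is algebraic of degree at most `D`. -/
noncomputable def controlledShifts (σ : ℂ) (N D X : ℕ) : Finset ℕ :=
  (Icc 1 N).filter fun a ↦ σ + a ≠ 0 ∧ (IsIntegral ℚ σ ∧ Module.finrank ℚ ℚ⟮σ⟯ ≤ D) ∧
    0 < shiftDenom σ a ∧ shiftDenom σ a ≤ X

theorem lcm_natAbs_sub_ne_zero (S : Finset ℕ) (a : ℕ) :
    ((S.erase a).lcm fun b ↦ ((b : ℤ) - a).natAbs) ≠ 0 := by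
  rw [Finset.lcm_ne_zero_iff]
  intro b hb
  have := ne_of_mem_erase hb
  omega

theorem lcm_natAbs_sub_le {S : Finset ℕ} {N a : ℕ} (hS : S ⊆ Icc 1 N) (ha : a ∈ Icc 1 N) :
    ((S.erase a).lcm fun b ↦ ((b : ℤ) - a).natAbs) ≤ N ^ #S := by
  have hN := (mem_Icc.1 ha).1.trans (mem_Icc.1 ha).2
  calc _ ≤ ∏ b ∈ S.erase a, ((b : ℤ) - a).natAbs :=
        Nat.le_of_dvd (prod_pos fun b hb ↦ by have := ne_of_mem_erase hb; omega)
          (Finset.lcm_dvd_prod _ _)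
    _ ≤ ∏ _b ∈ S.erase a, N := prod_le_prod' fun b hb ↦ by
        have h1 := mem_Icc.1 (hS (mem_of_mem_erase hb))
        have h2 := mem_Icc.1 ha
        omega
    _ = N ^ #(S.erase a) := prod_const _
    _ ≤ N ^ #S := Nat.pow_le_pow_right hN card_erase_le

theorem mem_controlledShifts_of_sum_inv_eq_zero {σ : ℂ} {S : Finset ℕ} {c : ℕ → ℤ} {N m : ℕ}
    (hSN : S ⊆ Icc 1 N) (hSm : #S ≤ m) (hc : ∀ v, (c v).natAbs ≤ m) (hS : ∀ v ∈ S, σ + v ≠ 0)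
    (hsum : ∑ v ∈ S, c v * (σ + v)⁻¹ = 0) {a : ℕ} (ha : a ∈ S) (hca : c a ≠ 0) :
    a ∈ controlledShifts σ N m (m * N ^ m) := by
  obtain ⟨hint, hfin⟩ := finrank_adjoin_le_card_of_sum_inv_eq_zero hS hsum ha hca
  have hdvd := Int.natCast_dvd.1 (shiftDenom_dvd_mul_lcm hS hsum ha)
  rw [Int.natAbs_mul, Int.natAbs_natCast] at hdvd
  have hpos := Nat.mul_pos (Int.natAbs_pos.2 hca)
    (Nat.pos_of_ne_zero (lcm_natAbs_sub_ne_zero S a))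
  have hN := (mem_Icc.1 (hSN ha)).1.trans (mem_Icc.1 (hSN ha)).2
  refine mem_filter.2 ⟨hSN ha, hS a ha, ⟨hint, hfin.trans hSm⟩, Nat.pos_of_dvd_of_pos hdvd hpos,
    (Nat.le_of_dvd hpos hdvd).trans (Nat.mul_le_mul (hc a) ?_)⟩
  exact (lcm_natAbs_sub_le hSN (hSN ha)).trans (Nat.pow_le_pow_right hN hSm)

theorem one_div_le_weight_mul_weight_of_sum_inv_eq_zero {σ : ℂ} {N m : ℕ} {x : Fin m → ℕ}
    {e : Fin m → ℤ} (he : ∀ i, (e i).natAbs = 1) (hxN : ∀ i, x i ∈ Icc 1 N)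
    (hx : ∀ i, σ + x i ≠ 0) (hsum : ∑ i, e i * (σ + x i)⁻¹ = 0) (k : Fin m) :
    1 / (N : ℝ) ≤
      weight (shiftDenom σ) (controlledShifts σ N m (m * N ^ m)) N (x k) ((Iio k).image x) *
      weight (shiftDenom σ) (controlledShifts σ N m (m * N ^ m)) N (x k) ((Ioi k).image x) := by
  set G := controlledShifts σ N m (m * N ^ m) with hG
  have hq : ∀ a ∈ G, 0 < shiftDenom σ a := fun a ha ↦ (mem_filter.1 ha).2.2.2.1
  have hN : 0 < N := (mem_Icc.1 (hxN k)).1.trans (mem_Icc.1 (hxN k)).2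
  by_cases hrep : ∃ j, j ≠ k ∧ x j = x k
  · obtain ⟨j, hjk, hj⟩ := hrep
    rcases lt_or_gt_of_ne hjk with h | h
    · rw [weight_eq_one_of_mem hq hN (mem_image.2 ⟨j, mem_Iio.2 h, hj⟩), one_mul]
      exact one_div_le_weight hq hN _ _
    · rw [weight_eq_one_of_mem hq hN (mem_image.2 ⟨j, mem_Ioi.2 h, hj⟩), mul_one]
      exact one_div_le_weight hq hN _ _
  push Not at hrep
  let c : ℕ → ℤ := fun v ↦ ∑ i with x i = v, e i
  have hck : c (x k) = e k := by
    have : (univ.filter fun i ↦ x i = x k) = {k} := by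
      ext i
      simp only [mem_filter, mem_univ, true_and, mem_singleton]
      exact ⟨fun h ↦ by_contra fun hik ↦ hrep i hik h, fun h ↦ by rw [h]⟩
    simp only [c, this, sum_singleton]
  have hc : ∀ v, (c v).natAbs ≤ m := fun v ↦ by
    refine (Int.natAbs_sum_le _ _).trans ?_
    simp only [he, sum_const, smul_eq_mul, mul_one]
    exact (card_le_univ _).trans (Fintype.card_fin m).le
  set S := (univ.image x).filter (c · ≠ 0) with hSdef
  have hSx : ∀ v ∈ S, ∃ i, x i = v := fun v hv ↦ by simpa using (mem_filter.1 hv).1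
  have hSN : S ⊆ Icc 1 N := fun v hv ↦ by
    obtain ⟨i, rfl⟩ := hSx v hv
    exact hxN i
  have hSm : #S ≤ m := (card_filter_le _ _).trans (card_image_le.trans (by simp))
  have hS : ∀ v ∈ S, σ + v ≠ 0 := fun v hv ↦ by
    obtain ⟨i, rfl⟩ := hSx v hv
    exact hx i
  have hSsum : ∑ v ∈ S, c v * (σ + v)⁻¹ = 0 := by
    rw [hSdef, sum_filter_of_ne (p := (c · ≠ 0)) (fun v _ h hv ↦ h (by simp [hv])), ← hsum,
      ← sum_fiberwise_of_maps_to (t := univ.image x) (g := x) (fun i _ ↦ by simp)]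
    refine sum_congr rfl fun v _ ↦ ?_
    simp only [c, Int.cast_sum, sum_mul]
    refine sum_congr rfl fun i hi ↦ ?_
    rw [(mem_filter.1 hi).2]
  have hSG : ∀ v ∈ S, v ∈ G := fun v hv ↦
    mem_controlledShifts_of_sum_inv_eq_zero hSN hSm hc hS hSsum hv (mem_filter.1 hv).2
  have hkS : x k ∈ S := mem_filter.2 ⟨by simp, by
    rw [hck]
    have := he k
    omega⟩
  refine one_div_le_weight_mul_weight hq hN (hSG _ hkS) ?_
  have hdvd := Int.natCast_dvd.1 (shiftDenom_dvd_mul_lcm hS hSsum hkS)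
  rw [Int.natAbs_mul, Int.natAbs_natCast, hck, he, one_mul] at hdvd
  refine (dvd_lcm_gcd hdvd).trans (Finset.lcm_mono fun v hv ↦ ?_)
  obtain ⟨hvk, hvS⟩ := mem_erase.1 hv
  obtain ⟨i, rfl⟩ := hSx v hvS
  refine mem_filter.2 ⟨?_, hSG _ hvS⟩
  have hik : i ≠ k := fun h ↦ hvk (by rw [h])
  rcases lt_or_gt_of_ne hik with h | h
  · exact mem_union_left _ (mem_image_of_mem x (mem_Iio.2 h))
  · exact mem_union_right _ (mem_image_of_mem x (mem_Ioi.2 h))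

/-- A bound for the number of solutions in terms of a bound for the sums of the weights. -/
theorem card_le_of_sum_weight_le {σ : ℂ} {N m : ℕ} (hN : 0 < N) {K : ℝ} (hK0 : 0 ≤ K)
    (hK : ∀ S, #S ≤ m → ∑ a ∈ Icc 1 N,
      weight (shiftDenom σ) (controlledShifts σ N m (m * N ^ m)) N a S ≤ K)
    {e : Fin m → ℤ} (he : ∀ i, (e i).natAbs = 1) :
    (#((Fintype.piFinset fun _ : Fin m ↦ Icc 1 N).filter fun x ↦
      (∀ i, σ + x i ≠ 0) ∧ ∑ i, e i * (σ + x i)⁻¹ = 0) : ℝ) ≤ √((N : ℝ) ^ m) * K ^ m := by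
  set F := (Fintype.piFinset fun _ : Fin m ↦ Icc 1 N).filter fun x ↦
      (∀ i, σ + x i ≠ 0) ∧ ∑ i, e i * (σ + x i)⁻¹ = 0 with hF
  set φ := weight (shiftDenom σ) (controlledShifts σ N m (m * N ^ m)) N
  have hφ : ∀ a S, 0 ≤ φ a S := weight_nonneg _ _ _
  have hN' : (0 : ℝ) < N := by exact_mod_cast hN
  set y := √((N : ℝ) ^ m) with hy
  have hy0 : 0 < y := Real.sqrt_pos.2 (by positivity)
  have hyy : y * y = (N : ℝ) ^ m := Real.mul_self_sqrt (by positivity)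
  have hpt : ∀ x ∈ F, 2 / y ≤
      ∏ k, φ (x k) ((Iio k).image x) + ∏ k, φ (x k) ((Ioi k).image x) := fun x hx ↦ by
    obtain ⟨h1, h2, h3⟩ := mem_filter.1 hx
    rw [Fintype.mem_piFinset] at h1
    have hprod : 1 / (N : ℝ) ^ m ≤
        (∏ k, φ (x k) ((Iio k).image x)) * ∏ k, φ (x k) ((Ioi k).image x) := by
      rw [← prod_mul_distrib]
      calc 1 / (N : ℝ) ^ m = ∏ _k : Fin m, 1 / (N : ℝ) := by simp
        _ ≤ _ := prod_le_prod (fun _ _ ↦ by positivity) fun k _ ↦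
          one_div_le_weight_mul_weight_of_sum_inv_eq_zero he h1 h2 h3 k
    set U := ∏ k, φ (x k) ((Iio k).image x)
    set V := ∏ k, φ (x k) ((Ioi k).image x)
    have hU : 0 ≤ U := prod_nonneg fun _ _ ↦ hφ _ _
    have hV : 0 ≤ V := prod_nonneg fun _ _ ↦ hφ _ _
    refine le_of_sq_le_sq ?_ (by positivity)
    have : (2 / y) ^ 2 = 4 * (1 / (N : ℝ) ^ m) := by rw [← hyy]; field_simp; norm_num
    nlinarith [sq_nonneg (U - V)]
  have hmain : #F * (2 / y) ≤ K ^ m + K ^ m := calc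
    #F * (2 / y) = ∑ _x ∈ F, 2 / y := by rw [sum_const, nsmul_eq_mul]
    _ ≤ ∑ x ∈ F, (∏ k, φ (x k) ((Iio k).image x) + ∏ k, φ (x k) ((Ioi k).image x)) :=
        sum_le_sum hpt
    _ ≤ ∑ x ∈ Fintype.piFinset fun _ : Fin m ↦ Icc 1 N,
          (∏ k, φ (x k) ((Iio k).image x) + ∏ k, φ (x k) ((Ioi k).image x)) :=
        sum_le_sum_of_subset_of_nonneg (filter_subset _ _) fun x _ _ ↦
          add_nonneg (prod_nonneg fun _ _ ↦ hφ _ _) (prod_nonneg fun _ _ ↦ hφ _ _)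
    _ ≤ K ^ m + K ^ m := by
        rw [sum_add_distrib]
        exact add_le_add (sum_piFinset_prod_Iio_le hφ hK0 hK)
          (sum_piFinset_prod_Ioi_le hφ hK0 hK le_rfl)
  rw [mul_div_assoc', div_le_iff₀ hy0] at hmain
  linarith

open IntermediateField in
theorem sum_weight_shiftDenom_le {σ : ℂ} {N m X : ℕ} (hN : 0 < N) (hm : 0 < m) {C η : ℝ}
    (hC1 : 1 ≤ C) (hη : 0 < η) (hX : 0 < X) (hC : ∀ n : ℕ, n ≠ 0 →
      ((∏ p ∈ n.primeFactors, m * (n.factorization p + 1) : ℕ) : ℝ) ≤ C * (n : ℝ) ^ η)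
    {S : Finset ℕ} (hS : #S ≤ m) :
    ∑ a ∈ Icc 1 N, weight (shiftDenom σ) (controlledShifts σ N m X) N a S ≤
      (m + 1 + (2 * m * C) ^ m * (2 + 2 * m * C * (1 + 1 / η))) * ((X : ℝ) ^ η) ^ (m + 2) := by
  set G := controlledShifts σ N m X with hG
  set Y := (X : ℝ) ^ η with hY
  have hm' : (1 : ℝ) ≤ m := by exact_mod_cast hm
  have hX' : (1 : ℝ) ≤ X := by exact_mod_cast hX
  have hY1 : 1 ≤ Y := Real.one_le_rpow hX' hη.le
  set B := 2 * m * C with hB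
  have hB1 : 1 ≤ B := by nlinarith
  have hM1 : 1 ≤ B * Y := by nlinarith
  have hlog : Real.log X ≤ Y / η := Real.log_le_rpow_div (by positivity) hη
  have hprod : ∀ a ∈ G, ((∏ p ∈ (shiftDenom σ a).primeFactors,
      m * ((shiftDenom σ a).factorization p + 1) : ℕ) : ℝ) ≤ C * Y := fun a ha ↦ by
    obtain ⟨-, -, -, h1, h2⟩ := mem_filter.1 ha
    refine (hC _ h1.ne').trans ?_
    rw [hY]
    gcongr
  have hCB : C * Y ≤ B * Y := by
    gcongr
    nlinarith
  have hcount : ∀ n ≠ 0, (#(G.filter (shiftDenom σ · = n)) : ℝ) ≤ B * Y := fun n hn ↦ by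
    rcases (G.filter (shiftDenom σ · = n)).eq_empty_or_nonempty with h | ⟨a, ha⟩
    · rw [h, card_empty, Nat.cast_zero]; linarith
    obtain ⟨haG, rfl⟩ := mem_filter.1 ha
    obtain ⟨-, -, ⟨hint, hfin⟩, -, -⟩ := mem_filter.1 haG
    have hcard := card_le_of_shiftDenom_eq hint (V := G.filter (shiftDenom σ · = shiftDenom σ a))
      (fun v hv ↦ (mem_filter.1 (mem_filter.1 hv).1).2.1) hn fun v hv ↦ (mem_filter.1 hv).2
    have hle : #(G.filter (shiftDenom σ · = shiftDenom σ a)) ≤ 2 * m *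
        ∏ p ∈ (shiftDenom σ a).primeFactors, m * ((shiftDenom σ a).factorization p + 1) :=
      hcard.trans (Nat.mul_le_mul (Nat.mul_le_mul_left _ hfin) (prod_le_prod' fun p _ ↦
        hfin.trans (Nat.le_mul_of_pos_right _ (Nat.succ_pos _))))
    calc (#(G.filter (shiftDenom σ · = shiftDenom σ a)) : ℝ) ≤ 2 * m *
        ((∏ p ∈ (shiftDenom σ a).primeFactors,
          m * ((shiftDenom σ a).factorization p + 1) : ℕ) : ℝ) := by exact_mod_cast hle
      _ ≤ 2 * m * (C * Y) := by gcongr; exact hprod a haG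
      _ = B * Y := by rw [hB]; ring
  have hdiv : ∀ a ∈ G, (#(shiftDenom σ a).divisors : ℝ) ≤ B * Y := fun a ha ↦ by
    refine le_trans ?_ ((hprod a ha).trans hCB)
    have h0 := (mem_filter.1 ha).2.2.2.1.ne'
    rw [Nat.card_divisors h0]
    exact_mod_cast prod_le_prod' fun p _ ↦ Nat.le_mul_of_pos_left _ hm
  have hgcd : ∀ a ∈ G, ∀ b ∈ G,
      (shiftDenom σ a).gcd ((b : ℤ) - a).natAbs ∣ shiftDenom σ b := fun a ha b hb ↦
    gcd_shiftDenom_dvd (mem_filter.1 ha).2.1 (mem_filter.1 hb).2.1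
      (mem_filter.1 ha).2.2.2.1.ne'
  have hY2 : 1 ≤ Y ^ (m + 2) := one_le_pow₀ hY1
  calc _ ≤ #S + 1 + (B * Y) ^ #S * (2 + B * Y * (1 + Real.log X)) :=
        sum_weight_le hN (filter_subset _ _) (fun a ha ↦ (mem_filter.1 ha).2.2.2) hgcd hM1
          hcount hdiv S
    _ ≤ m + 1 + (B * Y) ^ m * (2 + B * Y * (1 + Y / η)) := by
        have : 0 ≤ Real.log X := Real.log_nonneg hX'
        gcongr
    _ ≤ (m + 1) * Y ^ (m + 2) + (B * Y) ^ m * ((2 + B * (1 + 1 / η)) * Y ^ 2) := by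
        refine add_le_add (le_mul_of_one_le_right (by positivity) hY2) ?_
        gcongr
        have h1 : Y ≤ Y ^ 2 := le_self_pow₀ hY1 two_ne_zero
        have h2 : 1 ≤ Y ^ 2 := one_le_pow₀ hY1
        have h3 : B * Y * (1 + Y / η) = B * Y + B * (1 / η) * Y ^ 2 := by ring
        have h4 : B * Y ≤ B * Y ^ 2 := by gcongr
        rw [h3]
        linarith
    _ = _ := by ring

theorem exists_sum_weight_shiftDenom_le {m : ℕ} (hm : 0 < m) {δ : ℝ} (hδ : 0 < δ) :
    ∃ C : ℝ, 0 < C ∧ ∀ (σ : ℂ) (N : ℕ), 0 < N → ∀ S : Finset ℕ, #S ≤ m → ∑ a ∈ Icc 1 N,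
      weight (shiftDenom σ) (controlledShifts σ N m (m * N ^ m)) N a S ≤ C * (N : ℝ) ^ δ := by
  have hm_pos : (0 : ℝ) < m := by exact_mod_cast hm
  set η : ℝ := δ / (m * (m + 2)) with hη_def
  have hη : 0 < η := by positivity
  obtain ⟨C, hC1, hC⟩ := exists_prod_primeFactors_le_rpow hm hη
  refine ⟨(m + 1 + (2 * m * C) ^ m * (2 + 2 * m * C * (1 + 1 / η))) * (m : ℝ) ^ (δ / m),
    by positivity, fun σ N hN S hS ↦ ?_⟩
  refine (sum_weight_shiftDenom_le hN hm hC1 hη (by positivity) hC hS).trans_eq ?_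
  rw [mul_assoc (_ + _), ← Real.rpow_mul_natCast (by positivity)]
  have h1 : η * ((m + 2 : ℕ) : ℝ) = δ / m := by
    rw [hη_def]
    push_cast
    field_simp
  rw [h1, Nat.cast_mul, Nat.cast_pow, Real.mul_rpow (by positivity) (by positivity),
    ← Real.rpow_natCast_mul (by positivity), mul_div_cancel₀ _ (ne_of_gt hm_pos)]

/-- for fixed `r ≥ 1` and every `ε > 0` there is `C > 0` such that for every
`σ ∈ ℂ` and every `N ≥ 1`, the number `T_r(σ,N)` of tuples `(x_1,…,x_{2r})` of positive
integers `≤ N` with `σ + x_i ≠ 0` and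
`1/(σ+x_1)+…+1/(σ+x_r) = 1/(σ+x_{r+1})+…+1/(σ+x_{2r})` satisfies
`T_r(σ,N) ≤ C·N^{r+ε}`. -/
theorem stmt_19 (r : ℕ) (hr : 0 < r) (ε : ℝ) (hε : 0 < ε) :
    ∃ C : ℝ, 0 < C ∧
      ∀ (σ : ℂ) (N : ℕ), 0 < N →
        ((((Fintype.piFinset fun _ : Fin r => Finset.Icc 1 N) ×ˢ
              Fintype.piFinset fun _ : Fin r => Finset.Icc 1 N).filter
            (fun xy => (∀ i, σ + (xy.1 i : ℂ) ≠ 0) ∧ (∀ i, σ + (xy.2 i : ℂ) ≠ 0) ∧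
              (∑ i, (σ + (xy.1 i : ℂ))⁻¹) = ∑ i, (σ + (xy.2 i : ℂ))⁻¹)).card : ℝ) ≤
          C * (N : ℝ) ^ ((r : ℝ) + ε) := by
  have hr' : (0 : ℝ) < r := by exact_mod_cast hr
  obtain ⟨C, hC0, hC⟩ := exists_sum_weight_shiftDenom_le (m := r + r) (by omega)
    (δ := ε / (r + r)) (by positivity)
  refine ⟨C ^ (r + r), by positivity, fun σ N hN ↦ ?_⟩
  have hN' : (0 : ℝ) < N := by exact_mod_cast hN
  let e : Fin (r + r) → ℤ := Fin.append (fun _ ↦ 1) fun _ ↦ -1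
  have he : ∀ i, (e i).natAbs = 1 := fun i ↦ by
    refine Fin.addCases (fun j ↦ ?_) (fun j ↦ ?_) i <;> simp [e, -Fin.natAdd_eq_addNat]
  have hcard := card_le_of_sum_weight_le hN (by positivity) (hC σ N hN) he
  refine le_trans ?_ (hcard.trans_eq ?_)
  · refine Nat.cast_le.2 (card_le_card_of_injOn (fun p ↦ Fin.append p.1 p.2) (fun p hp ↦ ?_)
      fun p _ p' _ h ↦ ?_)
    · obtain ⟨h1, h2, h3, h4⟩ := mem_filter.1 (mem_coe.1 hp)
      rw [mem_product, Fintype.mem_piFinset, Fintype.mem_piFinset] at h1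
      refine mem_coe.2 (mem_filter.2 ⟨Fintype.mem_piFinset.2 fun i ↦ ?_, fun i ↦ ?_, ?_⟩)
      · refine Fin.addCases (fun j ↦ ?_) (fun j ↦ ?_) i
        · simpa using h1.1 j
        · simpa [-Fin.natAdd_eq_addNat] using h1.2 j
      · refine Fin.addCases (fun j ↦ ?_) (fun j ↦ ?_) i
        · simpa using h2 j
        · simpa [-Fin.natAdd_eq_addNat] using h3 j
      · rw [Fin.sum_univ_add]
        simp [e, -Fin.natAdd_eq_addNat, h4]
    · have h' : Fin.append p.1 p.2 = Fin.append p'.1 p'.2 := h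
      refine Prod.ext (funext fun i ↦ ?_) (funext fun i ↦ ?_)
      · simpa using congrFun h' (Fin.castAdd r i)
      · simpa [-Fin.natAdd_eq_addNat] using congrFun h' (Fin.natAdd r i)
  · rw [pow_add (N : ℝ), Real.sqrt_mul_self (by positivity), mul_pow,
      ← Real.rpow_mul_natCast hN'.le, Nat.cast_add, div_mul_cancel₀ _ (by positivity),
      Real.rpow_add hN', Real.rpow_natCast]
    ring
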